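/- Fix θ ∈ F with θ² = q and t ∈ ℤ. Let d ∈ ℕ and let V_d be the (d+1)-dimensional vector space with basis v_0, …, v_d, on which e, f, k act by k v_i = q^{d−2i} v_i, f v_i = [i+1]_q v_{i+1} (f v_d = 0), e v_i = [d−i+1]_q v_{i−1} (e v_0 = 0). Define endomorphisms x = k⁻¹ − k^{−1−t} e q^{1+t}(q − q⁻¹)θ⁻¹, y = k, z = k⁻¹ + f k^{t} q^{−t}(q − q⁻¹)θ of V_d, set n_x = q(1 − y z)/(q − q⁻¹), n_z = q(1 − x y)/(q − q⁻¹) (both nilpotent), let Y be the endomorphism with Y v_i = q^{2i(d−i)} v_i, and set Ω = exp_q(n_x) Y exp_q(n_z) and τ_y = exp_q(n_z) Ω. Then for 0 ≤ i ≤ d: τ_y v_i = (−1)^{d+i} θ^{d²} q^{i(i−d−1)} v_{d−i}. -/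

import Mathlib

namespace Lusztig

variable (F : Type*) [Field F] (q : F)



/-- The q-integer [n]_q = (qⁿ − q⁻ⁿ)/(q − q⁻¹). -/
noncomputable def qInt (n : ℤ) : F := (q ^ n - q ^ (-n)) / (q - q⁻¹)

/-- The q-factorial [n]!_q = [n]_q [n−1]_q ⋯ [1]_q, with [0]!_q = 1. -/
noncomputable def qFact (n : ℕ) : F := ∏ i ∈ Finset.range n, qInt F q ((i : ℤ) + 1)

/-- The q-exponential exp_q(φ) = Σ_{i≥0} q^{binom(i,2)} φ^i / [i]!_q of a nilpotent
endomorphism φ of a finite-dimensional space.  Since the nilpotency index of φ is at most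
`finrank F V`, the series may be truncated at `finrank F V + 1` terms. -/
noncomputable def expq {V : Type*} [AddCommGroup V] [Module F V] (φ : Module.End F V) :
    Module.End F V :=
  ∑ i ∈ Finset.range (Module.finrank F V + 1), (q ^ (i.choose 2) / qFact F q i) • φ ^ i

/-- The inverse of the q-exponential: exp_{q⁻¹}(−φ) = Σ_{i≥0} (−1)^i q^{−binom(i,2)} φ^i / [i]!_q. -/
noncomputable def expqInv {V : Type*} [AddCommGroup V] [Module F V] (φ : Module.End F V) :
    Module.End F V :=
  ∑ i ∈ Finset.range (Module.finrank F V + 1),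
    (((-1 : F) ^ i * (q ^ (i.choose 2))⁻¹) / qFact F q i) • φ ^ i

/-- The q-exponential for square matrices (truncated at n + 1 terms, which is enough
for nilpotent matrices). -/
noncomputable def expqM {n : ℕ} (φ : Matrix (Fin n) (Fin n) F) : Matrix (Fin n) (Fin n) F :=
  ∑ i ∈ Finset.range (n + 1), (q ^ (i.choose 2) / qFact F q i) • φ ^ i


/-- The matrix of the s-th power of k on the module V_d with basis v_0, …, v_d,
where k v_i = q^{d−2i} v_i. -/
noncomputable def km (d : ℕ) (s : ℤ) : Matrix (Fin (d + 1)) (Fin (d + 1)) F :=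
  Matrix.diagonal fun i => q ^ (s * ((d : ℤ) - 2 * (i : ℤ)))

/-- The matrix of f on V_d: f v_i = [i+1]_q v_{i+1} and f v_d = 0. -/
noncomputable def fm (d : ℕ) : Matrix (Fin (d + 1)) (Fin (d + 1)) F :=
  Matrix.of fun i j => if (i : ℕ) = (j : ℕ) + 1 then qInt F q ((j : ℤ) + 1) else 0

/-- The matrix of e on V_d: e v_i = [d−i+1]_q v_{i−1} and e v_0 = 0. -/
noncomputable def em (d : ℕ) : Matrix (Fin (d + 1)) (Fin (d + 1)) F :=
  Matrix.of fun i j => if (j : ℕ) = (i : ℕ) + 1 then qInt F q ((d : ℤ) - (j : ℤ) + 1) else 0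

section helpers
variable {F : Type*} [Field F] {q : F}

theorem aux_sub_ne (hq : q ≠ 0) (hroot : ∀ n : ℕ, 0 < n → q ^ n ≠ 1) : q - q⁻¹ ≠ 0 := by
  intro h
  have h2 := hroot 2 (by norm_num)
  apply h2
  field_simp at h
  linear_combination h

theorem qInt_ne (hq : q ≠ 0) (hroot : ∀ n : ℕ, 0 < n → q ^ n ≠ 1) (n : ℕ) :
    qInt F q ((n : ℤ) + 1) ≠ 0 := by
  unfold qInt
  refine div_ne_zero ?_ (aux_sub_ne hq hroot)
  intro h
  apply hroot (2 * (n + 1)) (by omega)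
  have h1 : q ^ ((n : ℤ) + 1) = q ^ (n + 1) := by
    exact_mod_cast zpow_natCast q (n + 1)
  rw [zpow_neg, h1] at h
  have h3 : q ^ (n + 1) ≠ 0 := pow_ne_zero _ hq
  rw [mul_comm, pow_mul]
  field_simp at h
  linear_combination h

theorem qFact_ne (hq : q ≠ 0) (hroot : ∀ n : ℕ, 0 < n → q ^ n ≠ 1) (n : ℕ) :
    qFact F q n ≠ 0 := by
  unfold qFact
  exact Finset.prod_ne_zero_iff.mpr fun i _ => qInt_ne hq hroot i

theorem qFact_succ (n : ℕ) : qFact F q (n + 1) = qFact F q n * qInt F q ((n : ℤ) + 1) := by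
  unfold qFact
  rw [Finset.prod_range_succ]

theorem qInt_inv (n : ℤ) : qInt F q⁻¹ n = qInt F q n := by
  unfold qInt
  rw [inv_inv, inv_zpow', inv_zpow', neg_neg, ← neg_sub (q ^ n), ← neg_sub q, neg_div_neg_eq]

theorem qFact_inv (n : ℕ) : qFact F q⁻¹ n = qFact F q n := by
  unfold qFact
  simp only [qInt_inv]

/-- symmetric q-binomial -/
noncomputable def qB (q : F) (n : ℕ) (k : ℤ) : F :=
  if 0 ≤ k ∧ k ≤ n then qFact F q n / (qFact F q k.toNat * qFact F q (n - k).toNat) else 0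

theorem qB_inv (n : ℕ) (k : ℤ) : qB q⁻¹ n k = qB q n k := by
  unfold qB
  simp only [qFact_inv]

theorem qB_add (k m : ℕ) : qB q (k + m) k = qFact F q (k + m) / (qFact F q k * qFact F q m) := by
  unfold qB
  rw [if_pos (by constructor <;> push_cast <;> omega)]
  congr 3
  push_cast
  omega

theorem qB_zero (n : ℕ) (k : ℤ) (h : k < 0 ∨ (n : ℤ) < k) : qB q n k = 0 := by
  unfold qB
  rw [if_neg (by omega)]

theorem qB_symm (n : ℕ) (k : ℤ) : qB q n (n - k) = qB q n k := by
  unfold qB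
  by_cases h : 0 ≤ k ∧ k ≤ n
  · rw [if_pos h, if_pos (by omega), sub_sub_cancel, mul_comm]
  · rw [if_neg h, if_neg (by omega)]

theorem qB_self (hq : q ≠ 0) (hroot : ∀ n : ℕ, 0 < n → q ^ n ≠ 1) (n : ℕ) : qB q n n = 1 := by
  have := qB_add (q := q) n 0
  rw [add_zero] at this
  rw [this]
  have := qFact_ne hq hroot n
  have h0 : qFact F q 0 = 1 := by simp [qFact]
  rw [h0]
  field_simp

theorem qB_z (hq : q ≠ 0) (hroot : ∀ n : ℕ, 0 < n → q ^ n ≠ 1) (n : ℕ) : qB q n 0 = 1 := by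
  have := qB_symm (q := q) n 0
  rw [← this, sub_zero, qB_self hq hroot]

theorem qInt_split (hq : q ≠ 0) (hroot : ∀ n : ℕ, 0 < n → q ^ n ≠ 1) (a b : ℤ) :
    qInt F q (a + b) = q ^ a * qInt F q b + q ^ (-b) * qInt F q a := by
  have := aux_sub_ne hq hroot
  unfold qInt
  rw [neg_add, zpow_add₀ hq, zpow_add₀ hq]
  ring

theorem qB_pascal (hq : q ≠ 0) (hroot : ∀ n : ℕ, 0 < n → q ^ n ≠ 1) (n : ℕ) (k : ℤ) :
    qB q (n + 1) k = q ^ k * qB q n k + q ^ (k - n - 1) * qB q n (k - 1) := by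
  rcases lt_trichotomy k 0 with h | h | h
  · rw [qB_zero _ _ (by omega), qB_zero _ _ (by omega), qB_zero _ _ (by omega)]; simp
  · subst h
    rw [qB_z hq hroot, qB_z hq hroot, qB_zero _ _ (by omega)]; simp
  · obtain ⟨j, rfl⟩ : ∃ j : ℕ, k = (j : ℤ) + 1 := ⟨(k - 1).toNat, by omega⟩
    rcases lt_trichotomy j n with h' | h' | h'
    · obtain ⟨m, rfl⟩ : ∃ m, n = j + 1 + m := ⟨n - (j + 1), by omega⟩
      have e1 := qB_add (q := q) (j + 1) (m + 1)
      have e2 := qB_add (q := q) (j + 1) m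
      have e3 := qB_add (q := q) j (m + 1)
      have c1 : j + (m + 1) = j + 1 + m := by ring
      rw [c1] at e3
      rw [← add_assoc] at e1
      push_cast at e1 e2
      rw [add_sub_cancel_right, e1, e2, e3, qFact_succ (j + 1 + m), qFact_succ j, qFact_succ m]
      have n1 := qFact_ne hq hroot j
      have n2 := qFact_ne hq hroot m
      have n3 := qInt_ne hq hroot j
      have n4 := qInt_ne hq hroot m
      have e4 := qInt_split hq hroot ((j : ℤ) + 1) ((m : ℤ) + 1)
      have c2 : ((j + 1 + m : ℕ) : ℤ) + 1 = (j : ℤ) + 1 + (m + 1) := by push_cast; ring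
      have c3 : (j : ℤ) + 1 - ((j + 1 + m : ℕ) : ℤ) - 1 = -((m : ℤ) + 1) := by push_cast; ring
      rw [c2, e4, c3]
      field_simp
    · subst h'
      have := qB_self hq hroot (j + 1)
      push_cast at this
      rw [this, qB_zero j _ (by omega), add_sub_cancel_right, qB_self hq hroot]
      simp
    · rw [qB_zero _ _ (by push_cast; omega), qB_zero _ _ (by omega), qB_zero _ _ (by omega)]; simp

theorem key (hq : q ≠ 0) (hroot : ∀ n : ℕ, 0 < n → q ^ n ≠ 1) (a : ℕ) : ∀ (n : ℕ) (k : ℤ),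
    ∑ c ∈ Finset.range (a + 1), (-1 : F) ^ c * q ^ ((c : ℤ) * (k - a + 1)) * qB q a c
        * qB q (a + n - c) k
      = q ^ (-(a : ℤ) * (a + n - k)) * qB q n (k - a) := by
  induction a with
  | zero =>
    intro n k
    have := qB_z hq hroot 0
    simp [this]
  | succ a ih =>
    intro n k
    have s1 : ∑ c ∈ Finset.range (a + 1 + 1), (-1 : F) ^ c * q ^ ((c : ℤ) * (k - (a + 1 : ℕ) + 1))
          * qB q (a + 1) c * qB q (a + 1 + n - c) k
        = ∑ c ∈ Finset.range (a + 1 + 1), (-1 : F) ^ c * q ^ ((c : ℤ) * (k - a + 1))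
          * qB q a c * qB q (a + (n + 1) - c) k
        + ∑ c ∈ Finset.range (a + 1 + 1), (-1 : F) ^ c * q ^ ((c : ℤ) * (k - a) + c - a - 1)
          * qB q a (c - 1) * qB q (a + 1 + n - c) k := by
      rw [← Finset.sum_add_distrib]
      refine Finset.sum_congr rfl fun c _ => ?_
      rw [qB_pascal hq hroot a c]
      have c1 : a + (n + 1) - c = a + 1 + n - c := by omega
      rw [c1]
      have p1 : q ^ ((c : ℤ) * (k - a + 1)) = q ^ ((c : ℤ) * (k - (a + 1 : ℕ) + 1)) * q ^ (c : ℤ) := by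
        rw [← zpow_add₀ hq]; congr 1; push_cast; ring
      have p2 : q ^ ((c : ℤ) * (k - a) + c - a - 1)
          = q ^ ((c : ℤ) * (k - (a + 1 : ℕ) + 1)) * q ^ ((c : ℤ) - a - 1) := by
        rw [← zpow_add₀ hq]; congr 1; push_cast; ring
      rw [p1, p2]
      ring
    rw [s1, Finset.sum_range_succ, ih (n + 1) k, qB_zero a ((a + 1 : ℕ) : ℤ) (by push_cast; omega),
      Finset.sum_range_succ', qB_zero a (((0 : ℕ) : ℤ) - 1) (by simp)]
    have s2 : ∑ c ∈ Finset.range (a + 1), (-1 : F) ^ (c + 1)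
          * q ^ (((c + 1 : ℕ) : ℤ) * (k - a) + ((c + 1 : ℕ) : ℤ) - a - 1)
          * qB q a (((c + 1 : ℕ) : ℤ) - 1) * qB q (a + 1 + n - (c + 1)) k
        = - q ^ (k - 2 * a) * (q ^ (-(a : ℤ) * (a + n - k)) * qB q n (k - a)) := by
      rw [← ih n k, Finset.mul_sum]
      refine Finset.sum_congr rfl fun c _ => ?_
      have c1 : a + 1 + n - (c + 1) = a + n - c := by omega
      have p1 : q ^ (((c + 1 : ℕ) : ℤ) * (k - a) + ((c + 1 : ℕ) : ℤ) - a - 1)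
          = q ^ (k - 2 * a) * q ^ ((c : ℤ) * (k - a + 1)) := by
        rw [← zpow_add₀ hq]; congr 1; push_cast; ring
      rw [c1, p1]
      push_cast
      rw [add_sub_cancel_right]
      ring
    rw [s2, qB_pascal hq hroot n (k - a)]
    have p1 : q ^ (k - 2 * a) * q ^ (-(a : ℤ) * (a + n - k))
        = q ^ (-(a : ℤ) * (a + (n + 1 : ℕ) - k)) * q ^ (k - a) := by
      rw [← zpow_add₀ hq, ← zpow_add₀ hq]; congr 1; push_cast; ring
    have p2 : q ^ (-((a + 1 : ℕ) : ℤ) * ((a + 1 : ℕ) + n - k))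
        = q ^ (-(a : ℤ) * (a + (n + 1 : ℕ) - k)) * q ^ (k - a - n - 1) := by
      rw [← zpow_add₀ hq]; congr 1; push_cast; ring
    rw [p2]
    have c2 : k - ((a + 1 : ℕ) : ℤ) = k - a - 1 := by push_cast; ring
    rw [c2]
    linear_combination (-qB q n (k - a)) * p1

theorem pow_up {n : ℕ} (N : Matrix (Fin n) (Fin n) F) (u : ℕ → F) (hu : ∀ i, u i ≠ 0)
    (hN : ∀ i j : Fin n, N i j = if (j : ℕ) = (i : ℕ) + 1 then u i / u j else 0) (m : ℕ) :
    ∀ i j : Fin n, (N ^ m) i j = if (j : ℕ) = (i : ℕ) + m then u i / u j else 0 := by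
  induction m with
  | zero =>
    intro i j
    rw [pow_zero, Matrix.one_apply]
    by_cases h : i = j
    · subst h; simp [hu]
    · have : ¬ (j : ℕ) = i := fun h' => h (Fin.ext h'.symm)
      simp [h, this]
  | succ m ih =>
    intro i j
    rw [pow_succ, Matrix.mul_apply]
    simp only [ih, hN]
    by_cases h : (j : ℕ) = i + (m + 1)
    · have hj := j.2
      rw [Finset.sum_eq_single (⟨i + m, by omega⟩ : Fin n)]
      · rw [if_pos rfl, if_pos (by simp only []; omega), if_pos h]
        have := hu (i + m)
        simp only []
        field_simp
      · intro b _ hb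
        have : ¬ (b : ℕ) = i + m := fun h' => hb (Fin.ext h')
        simp [this]
      · simp
    · rw [if_neg h]
      refine Finset.sum_eq_zero fun c _ => ?_
      by_cases h1 : (c : ℕ) = i + m
      · rw [if_neg (show ¬ (j : ℕ) = c + 1 by omega), mul_zero]
      · rw [if_neg h1, zero_mul]

theorem exp_up {n : ℕ} (N : Matrix (Fin n) (Fin n) F) (u : ℕ → F) (hu : ∀ i, u i ≠ 0)
    (hN : ∀ i j : Fin n, N i j = if (j : ℕ) = (i : ℕ) + 1 then u i / u j else 0) (i j : Fin n) :
    expqM F q N i j = if (i : ℕ) ≤ j then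
      q ^ (((j : ℕ) - i).choose 2) / qFact F q ((j : ℕ) - i) * (u i / u j) else 0 := by
  unfold expqM
  rw [Matrix.sum_apply]
  simp only [Matrix.smul_apply, pow_up N u hu hN, smul_eq_mul]
  have hj := j.2
  split_ifs with h
  · rw [Finset.sum_eq_single ((j : ℕ) - i)]
    · rw [if_pos (by omega)]
    · intro b _ hb
      rw [if_neg (by omega), mul_zero]
    · intro hb
      exact absurd (Finset.mem_range.mpr (by omega)) hb
  · refine Finset.sum_eq_zero fun c _ => ?_
    rw [if_neg (by omega), mul_zero]

theorem expqM_transpose {n : ℕ} (N : Matrix (Fin n) (Fin n) F) :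
    expqM F q N.transpose = (expqM F q N).transpose := by
  unfold expqM
  rw [Matrix.transpose_sum]
  simp [Matrix.transpose_pow, Matrix.transpose_smul]

theorem exp_down {n : ℕ} (N : Matrix (Fin n) (Fin n) F) (w : ℕ → F) (hw : ∀ i, w i ≠ 0)
    (hN : ∀ i j : Fin n, N i j = if (i : ℕ) = (j : ℕ) + 1 then w i / w j else 0) (i j : Fin n) :
    expqM F q N i j = if (j : ℕ) ≤ i then
      q ^ (((i : ℕ) - j).choose 2) / qFact F q ((i : ℕ) - j) * (w i / w j) else 0 := by
  have h := exp_up (q := q) N.transpose (fun i => (w i)⁻¹) (fun i => inv_ne_zero (hw i))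
    (fun a b => by
      rw [Matrix.transpose_apply, hN]
      congr 1
      rw [div_inv_eq_mul, mul_comm, div_eq_mul_inv]) j i
  rw [expqM_transpose, Matrix.transpose_apply] at h
  rw [h]
  congr 2
  rw [div_inv_eq_mul, mul_comm, div_eq_mul_inv]

theorem choose_pow {θ : F} (m : ℕ) : (θ ^ 2) ^ (m.choose 2) = θ ^ ((m : ℤ) * (m - 1)) := by
  rw [← pow_mul, ← zpow_natCast]
  congr 1
  have := Nat.triangle_succ (m - 1)
  cases m with
  | zero => simp
  | succ m =>
    rw [Nat.choose_two_right, Nat.mul_div_cancel' (Nat.even_mul_pred_self _).two_dvd]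
    push_cast
    simp

theorem nz_entry {θ : F} (hθ : θ ≠ 0) (hroot : ∀ n : ℕ, 0 < n → (θ ^ 2) ^ n ≠ 1) (t : ℤ) (d : ℕ)
    (x y nz : Matrix (Fin (d + 1)) (Fin (d + 1)) F)
    (hx : x = km F (θ ^ 2) d (-1) - ((θ ^ 2) ^ (1 + t) * (θ ^ 2 - (θ ^ 2)⁻¹) * θ⁻¹) •
      (km F (θ ^ 2) d (-1 - t) * em F (θ ^ 2) d))
    (hy : y = km F (θ ^ 2) d 1)
    (hnz : nz = (θ ^ 2 / (θ ^ 2 - (θ ^ 2)⁻¹)) • (1 - x * y)) (i j : Fin (d + 1)) :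
    nz i j = if (j : ℕ) = (i : ℕ) + 1 then
      (θ ^ (2 * t * i * (d - i) + i) * qFact F (θ ^ 2) (d - i)) /
        (θ ^ (2 * t * j * (d - j) + j) * qFact F (θ ^ 2) (d - j)) else 0 := by
  have hq : θ ^ 2 ≠ 0 := pow_ne_zero _ hθ
  have hs := aux_sub_ne hq hroot
  have hz : ∀ n : ℤ, (θ ^ 2) ^ n = θ ^ (2 * n) := fun n => by
    rw [zpow_mul]; norm_cast
  subst hx hy hnz
  simp only [km, em, Matrix.smul_apply, Matrix.sub_apply, Matrix.mul_diagonal,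
    Matrix.diagonal_mul, Matrix.of_apply, smul_eq_mul]
  by_cases h : (j : ℕ) = (i : ℕ) + 1
  · have hij : i ≠ j := fun h' => by rw [h'] at h; omega
    rw [if_pos h, if_pos h, Matrix.one_apply_ne hij, Matrix.diagonal_apply_ne _ hij]
    have hj := j.2
    obtain ⟨m, hm⟩ : ∃ m, d = i + 1 + m := ⟨d - (i + 1), by omega⟩
    have c1 : d - (i : ℕ) = m + 1 := by omega
    have c2 : d - (j : ℕ) = m := by omega
    have c3 : (d : ℤ) - (j : ℤ) + 1 = m + 1 := by omega
    rw [c1, c2, c3, qFact_succ]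
    have n1 := qFact_ne hq hroot m
    have hjz : ((j : ℕ) : ℤ) = i + 1 := by omega
    have hdz : (d : ℤ) = i + 1 + m := by omega
    generalize θ ^ 2 - (θ ^ 2)⁻¹ = r at hs ⊢
    simp only [hz, hjz, hdz]
    rw [div_eq_mul_inv (_ * _), mul_inv, ← zpow_neg]
    have e : θ ^ (2 * t * (i : ℤ) * (i + 1 + m - i) + i) * θ ^ (-(2 * t * ((i : ℤ) + 1) * (i + 1 + m - (i + 1)) + (i + 1)))
       = θ ^ 2 * θ ^ (2 * (1 + t)) * θ⁻¹ * θ ^ (2 * ((-1 - t) * ((i : ℤ) + 1 + m - 2 * i))) * θ ^ (2 * (1 * ((i : ℤ) + 1 + m - 2 * (i + 1)))) := by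
      have a1 : θ ^ 2 = θ ^ (2 : ℤ) := by norm_cast
      rw [a1, ← zpow_neg_one]
      simp only [← zpow_add₀ hθ]
      congr 1; ring
    field_simp
    field_simp at e
    linear_combination (-r * qInt F (θ ^ 2) (m + 1)) * e
  · rw [if_neg h, if_neg h]
    by_cases hij : i = j
    · subst hij
      simp only [Matrix.one_apply_eq, Matrix.diagonal_apply_eq]
      rw [mul_zero, mul_zero, sub_zero, ← zpow_add₀ hq]
      ring_nf; simp
    · rw [Matrix.one_apply_ne hij, Matrix.diagonal_apply_ne _ hij]
      simp

theorem nx_entry {θ : F} (hθ : θ ≠ 0) (hroot : ∀ n : ℕ, 0 < n → (θ ^ 2) ^ n ≠ 1) (t : ℤ) (d : ℕ)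
    (y z nx : Matrix (Fin (d + 1)) (Fin (d + 1)) F)
    (hy : y = km F (θ ^ 2) d 1)
    (hz : z = km F (θ ^ 2) d (-1) + ((θ ^ 2) ^ (-t) * (θ ^ 2 - (θ ^ 2)⁻¹) * θ) •
      (fm F (θ ^ 2) d * km F (θ ^ 2) d t))
    (hnx : nx = (θ ^ 2 / (θ ^ 2 - (θ ^ 2)⁻¹)) • (1 - y * z)) (i j : Fin (d + 1)) :
    nx i j = if (i : ℕ) = (j : ℕ) + 1 then
      ((-1) ^ (i : ℕ) * θ ^ (2 * t * i * (d - i) - i + 2 * (i * d - i * (i - 1))) * qFact F (θ ^ 2) i) /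
      ((-1) ^ (j : ℕ) * θ ^ (2 * t * j * (d - j) - j + 2 * (j * d - j * (j - 1))) * qFact F (θ ^ 2) j)
      else 0 := by
  have hq : θ ^ 2 ≠ 0 := pow_ne_zero _ hθ
  have hs := aux_sub_ne hq hroot
  have hzz : ∀ n : ℤ, (θ ^ 2) ^ n = θ ^ (2 * n) := fun n => by
    rw [zpow_mul]; norm_cast
  subst hz hy hnx
  simp only [km, fm, Matrix.smul_apply, Matrix.sub_apply, Matrix.add_apply, Matrix.mul_diagonal,
    Matrix.diagonal_mul, Matrix.of_apply, smul_eq_mul]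
  by_cases h : (i : ℕ) = (j : ℕ) + 1
  · have hij : i ≠ j := fun h' => by rw [h'] at h; omega
    rw [if_pos h, if_pos h, Matrix.one_apply_ne hij, Matrix.diagonal_apply_ne _ hij]
    have n1 := qFact_ne hq hroot j
    have hjz : ((i : ℕ) : ℤ) = j + 1 := by omega
    rw [h, qFact_succ]
    push_cast
    generalize θ ^ 2 - (θ ^ 2)⁻¹ = r at hs ⊢
    simp only [hzz]
    rw [div_eq_mul_inv (_ * _), mul_inv, mul_inv, ← zpow_neg, pow_succ]
    have e : θ ^ (2 * t * ((j : ℤ) + 1) * (d - (j + 1)) - (j + 1) + 2 * ((j + 1) * d - (j + 1) * (j + 1 - 1)))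
         * θ ^ (-(2 * t * (j : ℤ) * (d - j) - j + 2 * (j * d - j * (j - 1))))
       = θ ^ 2 * θ ^ (2 * (1 * ((d : ℤ) - 2 * (j + 1)))) * θ ^ (2 * (-t)) * θ * θ ^ (2 * (t * ((d : ℤ) - 2 * j))) := by
      have a1 : θ ^ 2 = θ ^ (2 : ℤ) := by norm_cast
      conv_rhs => rw [a1]; enter [1, 2]; rw [← zpow_one θ]
      simp only [← zpow_add₀ hθ]
      congr 1; ring
    have e2 : ((-1 : F) ^ (j : ℕ)) ≠ 0 := by simp
    field_simp
    field_simp at e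
    linear_combination (r * (-1) ^ (j : ℕ) * qInt F (θ ^ 2) (j + 1)) * e
  · rw [if_neg h, if_neg h]
    by_cases hij : i = j
    · subst hij
      simp only [Matrix.one_apply_eq, Matrix.diagonal_apply_eq]
      rw [zero_mul, mul_zero, add_zero, ← zpow_add₀ hq]
      ring_nf; simp
    · rw [Matrix.one_apply_ne hij, Matrix.diagonal_apply_ne _ hij]
      simp

theorem E_entry {θ : F} (hθ : θ ≠ 0) (hroot : ∀ n : ℕ, 0 < n → (θ ^ 2) ^ n ≠ 1) (t : ℤ) (d : ℕ)
    (x y nz : Matrix (Fin (d + 1)) (Fin (d + 1)) F)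
    (hx : x = km F (θ ^ 2) d (-1) - ((θ ^ 2) ^ (1 + t) * (θ ^ 2 - (θ ^ 2)⁻¹) * θ⁻¹) •
      (km F (θ ^ 2) d (-1 - t) * em F (θ ^ 2) d))
    (hy : y = km F (θ ^ 2) d 1)
    (hnz : nz = (θ ^ 2 / (θ ^ 2 - (θ ^ 2)⁻¹)) • (1 - x * y)) (a b : Fin (d + 1)) :
    expqM F (θ ^ 2) nz a b =
      θ ^ (((b : ℤ) - a) * (b - a - 1) + (2 * t * a * (d - a) + a) - (2 * t * b * (d - b) + b)) *
        qB (θ ^ 2) (d - a) (d - b) := by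
  have hq : θ ^ 2 ≠ 0 := pow_ne_zero _ hθ
  rw [exp_up nz (fun i => θ ^ (2 * t * i * (d - i) + i) * qFact F (θ ^ 2) (d - i))
    (fun i => mul_ne_zero (zpow_ne_zero _ hθ) (qFact_ne hq hroot _))
    (nz_entry hθ hroot t d x y nz hx hy hnz)]
  have hb := b.2
  split_ifs with h
  · obtain ⟨m, hm⟩ : ∃ m, (b : ℕ) = a + m := ⟨b - a, by omega⟩
    obtain ⟨l, hl⟩ : ∃ l, d = b + l := ⟨d - b, by omega⟩
    have c1 : (b : ℕ) - a = m := by omega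
    have c2 : d - (a : ℕ) = l + m := by omega
    have c3 : d - (b : ℕ) = l := by omega
    have c4 : (d : ℤ) - (b : ℕ) = l := by omega
    have c5 : ((b : ℕ) : ℤ) - (a : ℕ) = m := by omega
    rw [c1, c2, c3, c4, c5, qB_add, choose_pow, zpow_sub₀ hθ, zpow_add₀ hθ]
    have n1 := qFact_ne hq hroot m
    have n2 := qFact_ne hq hroot l
    field_simp
    rw [zpow_add₀ hθ, zpow_add₀ hθ]
    ring
  · rw [qB_zero _ _ (by omega), mul_zero]

theorem X_entry {θ : F} (hθ : θ ≠ 0) (hroot : ∀ n : ℕ, 0 < n → (θ ^ 2) ^ n ≠ 1) (t : ℤ) (d : ℕ)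
    (y z nx : Matrix (Fin (d + 1)) (Fin (d + 1)) F)
    (hy : y = km F (θ ^ 2) d 1)
    (hz : z = km F (θ ^ 2) d (-1) + ((θ ^ 2) ^ (-t) * (θ ^ 2 - (θ ^ 2)⁻¹) * θ) •
      (fm F (θ ^ 2) d * km F (θ ^ 2) d t))
    (hnx : nx = (θ ^ 2 / (θ ^ 2 - (θ ^ 2)⁻¹)) • (1 - y * z)) (a b : Fin (d + 1)) :
    expqM F (θ ^ 2) nx a b =
      (-1) ^ (a : ℕ) * (-1) ^ (b : ℕ) * θ ^ (((a : ℤ) - b) * (a - b - 1)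
        + (2 * t * a * (d - a) - a + 2 * (a * d - a * (a - 1)))
        - (2 * t * b * (d - b) - b + 2 * (b * d - b * (b - 1)))) * qB (θ ^ 2) a b := by
  have hq : θ ^ 2 ≠ 0 := pow_ne_zero _ hθ
  rw [exp_down nx (fun i => (-1) ^ i * θ ^ (2 * t * i * (d - i) - i + 2 * (i * d - i * (i - 1)))
      * qFact F (θ ^ 2) i)
    (fun i => mul_ne_zero (mul_ne_zero (by simp) (zpow_ne_zero _ hθ)) (qFact_ne hq hroot _))
    (nx_entry hθ hroot t d y z nx hy hz hnx)]
  split_ifs with h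
  · obtain ⟨m, hm⟩ : ∃ m, (a : ℕ) = b + m := ⟨a - b, by omega⟩
    have c1 : (a : ℕ) - b = m := by omega
    have c5 : ((a : ℕ) : ℤ) - (b : ℕ) = m := by omega
    have n1 := qFact_ne hq hroot m
    have n2 := qFact_ne hq hroot b
    have c6 : qB (θ ^ 2) a b = qFact F (θ ^ 2) a / (qFact F (θ ^ 2) b * qFact F (θ ^ 2) m) := by
      rw [hm, qB_add]
    rw [c1, c5, c6, choose_pow, zpow_sub₀ hθ, zpow_add₀ hθ]
    have e2 : ((-1 : F) ^ (b : ℕ)) * (-1 : F) ^ (b : ℕ) = 1 := by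
      rw [← mul_pow]; simp
    have e3 : ((-1 : F) ^ (b : ℕ))⁻¹ = (-1 : F) ^ (b : ℕ) := by
      exact (eq_inv_of_mul_eq_one_left e2).symm
    rw [div_eq_mul_inv (_ * _ * _) (_ * _ * _), mul_inv, mul_inv, e3]
    field_simp
    rw [zpow_add₀ hθ, zpow_add₀ hθ]
    ring
  · rw [qB_zero _ _ (by omega), mul_zero]

theorem W_entry {θ : F} (hθ : θ ≠ 0) (hroot : ∀ n : ℕ, 0 < n → (θ ^ 2) ^ n ≠ 1) (t : ℤ) (d : ℕ)
    (x y z nx nz Y : Matrix (Fin (d + 1)) (Fin (d + 1)) F)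
    (hx : x = km F (θ ^ 2) d (-1) - ((θ ^ 2) ^ (1 + t) * (θ ^ 2 - (θ ^ 2)⁻¹) * θ⁻¹) •
      (km F (θ ^ 2) d (-1 - t) * em F (θ ^ 2) d))
    (hy : y = km F (θ ^ 2) d 1)
    (hz : z = km F (θ ^ 2) d (-1) + ((θ ^ 2) ^ (-t) * (θ ^ 2 - (θ ^ 2)⁻¹) * θ) •
      (fm F (θ ^ 2) d * km F (θ ^ 2) d t))
    (hnx : nx = (θ ^ 2 / (θ ^ 2 - (θ ^ 2)⁻¹)) • (1 - y * z))
    (hnz : nz = (θ ^ 2 / (θ ^ 2 - (θ ^ 2)⁻¹)) • (1 - x * y))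
    (hY : Y = Matrix.diagonal fun i : Fin (d + 1) => (θ ^ 2) ^ (2 * (i : ℕ) * (d - (i : ℕ))))
    (a b : Fin (d + 1)) :
    (expqM F (θ ^ 2) nx * Y * expqM F (θ ^ 2) nz) a b =
      (-1) ^ (a : ℕ) * θ ^ (2 * t * a * (d - a) - 2 * t * b * (d - b) + a - b - a * (a + 1)
        + 2 * a * (d - b) + b * (b - 1)) * qB (θ ^ 2) (d - a) b := by
  have hq : θ ^ 2 ≠ 0 := pow_ne_zero _ hθ
  have hzz : ∀ n : ℤ, (θ ^ 2) ^ n = θ ^ (2 * n) := fun n => by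
    rw [zpow_mul]; norm_cast
  have ha := a.2
  have hb := b.2
  rw [Matrix.mul_apply]
  simp only [hY, Matrix.mul_diagonal, X_entry hθ hroot t d y z nx hy hz hnx,
    E_entry hθ hroot t d x y nz hx hy hnz]
  have k1 := key hq hroot a (d - a) ((d : ℤ) - b)
  have c0 : (d : ℤ) - b - a = (d - (a : ℕ) : ℕ) - b := by omega
  rw [c0, qB_symm] at k1
  have s0 : (-1 : F) ^ (a : ℕ) * θ ^ (2 * t * a * (d - a) - 2 * t * b * (d - b) + a - b - a * (a + 1)
        + 2 * a * (d - b) + b * (b - 1)) * qB (θ ^ 2) (d - a) b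
      = ((-1) ^ (a : ℕ) * θ ^ (2 * t * a * (d - a) - 2 * t * b * (d - b) + a - b - a * (a + 1)
        + 2 * a * (d - b) + b * (b - 1) + 2 * a * b)) *
        ((θ ^ 2) ^ (-((a : ℕ) : ℤ) * ((a : ℕ) + (d - (a : ℕ) : ℕ) - (d - (b : ℕ)))) * qB (θ ^ 2) (d - a) b) := by
    have c1 : -((a : ℕ) : ℤ) * ((a : ℕ) + (d - (a : ℕ) : ℕ) - (d - (b : ℕ))) = - a * b := by
      rw [Nat.cast_sub (by omega)]; ring
    rw [c1, hzz]
    have e : θ ^ (2 * t * (a : ℤ) * (d - a) - 2 * t * b * (d - b) + a - b - a * (a + 1)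
        + 2 * a * (d - b) + b * (b - 1)) = θ ^ (2 * t * (a : ℤ) * (d - a) - 2 * t * b * (d - b) + a - b - a * (a + 1)
        + 2 * a * (d - b) + b * (b - 1) + 2 * a * b) * θ ^ (2 * (-(a : ℤ) * b)) := by
      rw [← zpow_add₀ hθ]; congr 1; ring
    rw [e]; ring
  rw [s0, ← k1, Finset.mul_sum]
  rw [Fin.sum_univ_eq_sum_range (fun c : ℕ => (-1 : F) ^ (a : ℕ) * (-1) ^ c * θ ^ (((a : ℤ) - c) * (a - c - 1)
        + (2 * t * a * (d - a) - a + 2 * (a * d - a * (a - 1)))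
        - (2 * t * c * (d - c) - c + 2 * (c * d - c * (c - 1)))) * qB (θ ^ 2) a c
        * (θ ^ 2) ^ (2 * c * (d - c)) *
        (θ ^ (((b : ℤ) - c) * (b - c - 1) + (2 * t * c * (d - c) + c) - (2 * t * b * (d - b) + b)) *
        qB (θ ^ 2) (d - c) (d - b)))]
  symm
  refine Finset.sum_subset_zero_on_sdiff (Finset.range_subset_range.mpr (by omega)) ?_ ?_
  · intro c hc
    rw [Finset.mem_sdiff, Finset.mem_range, Finset.mem_range] at hc
    rw [qB_zero (a : ℕ) _ (by omega)]
    ring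
  · intro c hc
    rw [Finset.mem_range] at hc
    have c1 : (a : ℕ) + (d - a) - c = d - c := by omega
    have c2 : (θ ^ 2) ^ (2 * c * (d - c)) = θ ^ (2 * (2 * (c : ℤ) * (d - c))) := by
      rw [← hzz, ← zpow_natCast]
      congr 1
      push_cast [show c ≤ d by omega]
      ring
    rw [c1, c2, ← c0, hzz]
    have e : θ ^ (2 * t * (a : ℤ) * (d - a) - 2 * t * b * (d - b) + a - b - a * (a + 1)
        + 2 * a * (d - b) + b * (b - 1) + 2 * a * b) * θ ^ (2 * ((c : ℤ) * (d - b - a + 1)))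
      = θ ^ (((a : ℤ) - c) * (a - c - 1)
        + (2 * t * a * (d - a) - a + 2 * (a * d - a * (a - 1)))
        - (2 * t * c * (d - c) - c + 2 * (c * d - c * (c - 1)))) * θ ^ (2 * (2 * (c : ℤ) * (d - c)))
        * θ ^ (((b : ℤ) - c) * (b - c - 1) + (2 * t * c * (d - c) + c) - (2 * t * b * (d - b) + b)) := by
      simp only [← zpow_add₀ hθ]
      congr 1; ring
    linear_combination ((-1 : F) ^ (a : ℕ) * (-1) ^ c * qB (θ ^ 2) a c * qB (θ ^ 2) (d - c) (d - b)) * e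

theorem T_entry {θ : F} (hθ : θ ≠ 0) (hroot : ∀ n : ℕ, 0 < n → (θ ^ 2) ^ n ≠ 1) (t : ℤ) (d : ℕ)
    (x y z nx nz Y : Matrix (Fin (d + 1)) (Fin (d + 1)) F)
    (hx : x = km F (θ ^ 2) d (-1) - ((θ ^ 2) ^ (1 + t) * (θ ^ 2 - (θ ^ 2)⁻¹) * θ⁻¹) •
      (km F (θ ^ 2) d (-1 - t) * em F (θ ^ 2) d))
    (hy : y = km F (θ ^ 2) d 1)
    (hz : z = km F (θ ^ 2) d (-1) + ((θ ^ 2) ^ (-t) * (θ ^ 2 - (θ ^ 2)⁻¹) * θ) •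
      (fm F (θ ^ 2) d * km F (θ ^ 2) d t))
    (hnx : nx = (θ ^ 2 / (θ ^ 2 - (θ ^ 2)⁻¹)) • (1 - y * z))
    (hnz : nz = (θ ^ 2 / (θ ^ 2 - (θ ^ 2)⁻¹)) • (1 - x * y))
    (hY : Y = Matrix.diagonal fun i : Fin (d + 1) => (θ ^ 2) ^ (2 * (i : ℕ) * (d - (i : ℕ))))
    (a b : Fin (d + 1)) :
    (expqM F (θ ^ 2) nz * (expqM F (θ ^ 2) nx * Y * expqM F (θ ^ 2) nz)) a b =
      if (a : ℕ) + b = d then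
      (-1) ^ (a : ℕ) * θ ^ ((a : ℤ) * a + b * b - 2 * b) else 0 := by
  have hq : θ ^ 2 ≠ 0 := pow_ne_zero _ hθ
  have hzz : ∀ n : ℤ, ((θ ^ 2)⁻¹) ^ n = θ ^ (-2 * n) := fun n => by
    rw [zpow_mul, zpow_neg]; norm_cast
  have hroot' : ∀ n : ℕ, 0 < n → ((θ ^ 2)⁻¹) ^ n ≠ 1 := fun n hn h => by
    rw [inv_pow, inv_eq_one] at h
    exact hroot n hn h
  have ha := a.2
  have hb := b.2
  rw [Matrix.mul_apply]
  simp only [W_entry hθ hroot t d x y z nx nz Y hx hy hz hnx hnz hY,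
    E_entry hθ hroot t d x y nz hx hy hnz]
  have k1 := key (inv_ne_zero hq) hroot' (d - a) 0 (b : ℤ)
  simp only [qB_inv] at k1
  rw [Fin.sum_univ_eq_sum_range (fun c : ℕ =>
    θ ^ (((c : ℤ) - a) * (c - a - 1) + (2 * t * a * (d - a) + a) - (2 * t * c * (d - c) + c)) *
        qB (θ ^ 2) (d - a) (d - c) * ((-1) ^ (c : ℕ) * θ ^ (2 * t * c * (d - c) - 2 * t * b * (d - b) + c - b - c * (c + 1)
        + 2 * c * (d - b) + b * (b - 1)) * qB (θ ^ 2) (d - c) b))]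
  have c1 : d + 1 = a + (d - a + 1) := by omega
  rw [show Finset.range (d + 1) = Finset.range (a + (d - a + 1)) by rw [← c1], Finset.sum_range_add, Finset.sum_eq_zero, zero_add]
  · have s1 : ∀ c ∈ Finset.range (d - (a : ℕ) + 1),
      θ ^ ((((a + c : ℕ) : ℤ) - a) * (((a + c : ℕ) : ℤ) - a - 1) + (2 * t * a * (d - a) + a) - (2 * t * ((a + c : ℕ) : ℤ) * (d - ((a + c : ℕ) : ℤ)) + ((a + c : ℕ) : ℤ))) *
        qB (θ ^ 2) (d - a) (d - ((a + c : ℕ) : ℤ)) * ((-1) ^ ((a : ℕ) + c) * θ ^ (2 * t * ((a + c : ℕ) : ℤ) * (d - ((a + c : ℕ) : ℤ)) - 2 * t * b * (d - b) + ((a + c : ℕ) : ℤ) - b - ((a + c : ℕ) : ℤ) * (((a + c : ℕ) : ℤ) + 1)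
        + 2 * ((a + c : ℕ) : ℤ) * (d - b) + b * (b - 1)) * qB (θ ^ 2) (d - (a + c)) b) =
      ((-1) ^ (a : ℕ) * θ ^ (2 * t * a * (d - a) - 2 * t * b * (d - b) + a - b - a * (a + 1)
        + 2 * a * (d - b) + b * (b - 1))) * ((-1 : F) ^ c * ((θ ^ 2)⁻¹) ^ ((c : ℤ) * (b - (d - a : ℕ) + 1)) * qB (θ ^ 2) (d - a) c
        * qB (θ ^ 2) (d - a + 0 - c) b) := by
      intro c hc
      have d1 : (d : ℤ) - ((a + c : ℕ) : ℤ) = (d - (a : ℕ) : ℕ) - c := by omega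
      have d2 : d - ((a : ℕ) + c) = d - a + 0 - c := by omega
      have d3 : ((d - (a : ℕ) : ℕ) : ℤ) = d - a := by omega
      have d4 : qB (θ ^ 2) (d - a) (d - ((a + c : ℕ) : ℤ)) = qB (θ ^ 2) (d - a) c := by
        rw [d1, qB_symm]
      rw [d4, d2, d3, hzz, pow_add]
      have e : θ ^ ((((a + c : ℕ) : ℤ) - a) * (((a + c : ℕ) : ℤ) - a - 1) + (2 * t * a * (d - a) + a) - (2 * t * ((a + c : ℕ) : ℤ) * (d - ((a + c : ℕ) : ℤ)) + ((a + c : ℕ) : ℤ))) * θ ^ (2 * t * ((a + c : ℕ) : ℤ) * (d - ((a + c : ℕ) : ℤ)) - 2 * t * b * (d - b) + ((a + c : ℕ) : ℤ) - b - ((a + c : ℕ) : ℤ) * (((a + c : ℕ) : ℤ) + 1)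
        + 2 * ((a + c : ℕ) : ℤ) * (d - b) + b * (b - 1)) = θ ^ (2 * t * (a : ℤ) * (d - a) - 2 * t * b * (d - b) + a - b - a * (a + 1)
        + 2 * a * (d - b) + b * (b - 1)) * θ ^ (-2 * ((c : ℤ) * (b - (d - a) + 1))) := by
        rw [← zpow_add₀ hθ, ← zpow_add₀ hθ]; congr 1; push_cast; ring
      linear_combination ((-1 : F) ^ (a : ℕ) * (-1) ^ c * qB (θ ^ 2) (d - a) c * qB (θ ^ 2) (d - a + 0 - c) b) * e
    rw [Finset.sum_congr rfl s1, ← Finset.mul_sum, k1]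
    split_ifs with h
    · have d1 : ((b : ℕ) : ℤ) - ((d - (a : ℕ) : ℕ) : ℤ) = 0 := by omega
      have d2 : (((d - (a : ℕ) : ℕ) : ℤ) + ((0 : ℕ) : ℤ) - ((b : ℕ) : ℤ)) = 0 := by omega
      rw [d1, d2, qB_z hq hroot, mul_zero, zpow_zero, mul_one, mul_one]
      congr 2
      have d3 : (d : ℤ) = a + b := by omega
      rw [d3]; ring
    · rw [qB_zero _ _ (by omega)]; ring
  · intro c hc
    rw [Finset.mem_range] at hc
    rw [qB_zero (d - (a : ℕ)) _ (by omega)]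
    ring

end helpers

/-- on V_d, with x, y, z the equitable generators obtained from the primary
identification of type (θ, t) (θ² = q), and τ_y = exp_q(n_z) Ω where
Ω = exp_q(n_x) Y exp_q(n_z), one has τ_y v_i = (−1)^{d+i} θ^{d²} q^{i(i−d−1)} v_{d−i};
that is, τ_y = (−1)^d θ^{d²} T⁻¹ where T is the Lusztig operator. -/
theorem stmt18 (hq : q ≠ 0) (hroot : ∀ n : ℕ, 0 < n → q ^ n ≠ 1)
    (θ : F) (hθ : θ ^ 2 = q) (t : ℤ) (d : ℕ)
    (x y z nx nz Y Ω τy : Matrix (Fin (d + 1)) (Fin (d + 1)) F)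
    (hx : x = km F q d (-1) - (q ^ (1 + t) * (q - q⁻¹) * θ⁻¹) • (km F q d (-1 - t) * em F q d))
    (hy : y = km F q d 1)
    (hz : z = km F q d (-1) + (q ^ (-t) * (q - q⁻¹) * θ) • (fm F q d * km F q d t))
    (hnx : nx = (q / (q - q⁻¹)) • (1 - y * z))
    (hnz : nz = (q / (q - q⁻¹)) • (1 - x * y))
    (hY : Y = Matrix.diagonal fun i : Fin (d + 1) => q ^ (2 * (i : ℕ) * (d - (i : ℕ))))
    (hΩ : Ω = expqM F q nx * Y * expqM F q nz)
    (hτ : τy = expqM F q nz * Ω) :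
    ∀ i : Fin (d + 1),
      τy.mulVec (Pi.single i 1) =
        ((-1 : F) ^ (d + (i : ℕ)) * θ ^ (d ^ 2) * q ^ ((i : ℤ) * ((i : ℤ) - (d : ℤ) - 1))) •
          (Pi.single (Fin.rev i) 1 : Fin (d + 1) → F) := by
  intro i
  subst hθ
  have hθ : θ ≠ 0 := fun h => hq (by rw [h]; simp)
  have hi := i.2
  rw [Matrix.mulVec_single_one]
  ext a
  rw [Matrix.col_apply, hτ, hΩ, T_entry hθ hroot t d x y z nx nz Y hx hy hz hnx hnz hY]
  rw [Pi.smul_apply, smul_eq_mul, Pi.single_apply]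
  have hiff : (a = Fin.rev i) ↔ (a : ℕ) + i = d := by
    rw [Fin.ext_iff, Fin.val_rev]; omega
  by_cases h : (a : ℕ) + i = d
  · rw [if_pos h, if_pos (hiff.mpr h), mul_one]
    have hz2 : ∀ n : ℤ, (θ ^ 2) ^ n = θ ^ (2 * n) := fun n => by
      rw [zpow_mul]; norm_cast
    have e1 : (-1 : F) ^ (d + (i : ℕ)) = (-1) ^ (a : ℕ) := by
      rw [show d + (i : ℕ) = a + 2 * i by omega, pow_add, pow_mul]; simp
    rw [e1, hz2, ← zpow_natCast θ (d ^ 2), mul_assoc, ← zpow_add₀ hθ]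
    congr 2
    have hd : (d : ℤ) = a + i := by omega
    push_cast
    rw [hd]; ring
  · rw [if_neg h, if_neg (fun h' => h (hiff.mp h')), mul_zero]

end Lusztig
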